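/- Let r ≥ 1 and 1 ≤ s ≤ r, and let P ∈ ℤ[x_1, …, x_r, q] be any polynomial not involving the variable x_s. Then x_s (1 + q x_{s+1}) P ≈ x_{s+1} (1 + q x_{s−1}) P, where by convention x_0 = 0 and x_{r+1} = 1. -/

import Mathlib

open PowerSeries

noncomputable section

/-- The product (coefficientwise) topology on `ℚ⟦X⟧`. -/
instance : TopologicalSpace ℚ⟦X⟧ :=
  inferInstanceAs (TopologicalSpace ((Unit →₀ ℕ) → ℚ))

/-- `(q)_n = ∏_{i=1}^n (1 - q^i)` in `ℚ⟦X⟧`. -/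
def qp (n : ℕ) : ℚ⟦X⟧ := ∏ i ∈ Finset.range n, (1 - X ^ (i + 1))

/-- `(-q)_n = ∏_{i=1}^n (1 + q^i)` in `ℚ⟦X⟧`. -/
def nqp (n : ℕ) : ℚ⟦X⟧ := ∏ i ∈ Finset.range n, (1 + X ^ (i + 1))

/-- The Gaussian binomial `[M, N]_q`, zero unless `M ≥ N`. -/
def qbinom (M N : ℕ) : ℚ⟦X⟧ :=
  if N ≤ M then qp M * ((qp N)⁻¹ * (qp (M - N))⁻¹) else 0

/-- Weakly decreasing tuples `f 0 ≥ f 1 ≥ … ≥ f (r-1) ≥ 0`, encoded as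
antitone functions `ℕ → ℕ` vanishing from index `r` on. -/
def DecTuple (r : ℕ) : Type :=
  {f : ℕ → ℕ // (∀ ⦃i j : ℕ⦄, i ≤ j → f j ≤ f i) ∧ ∀ i, r ≤ i → f i = 0}

/-- `(q)_λ = (q)_{λ_1-λ_2} ⋯ (q)_{λ_{r-1}-λ_r} (q)_{λ_r}` for a weakly
decreasing tuple `λ` (0-indexed). -/
def qpT (r : ℕ) (f : ℕ → ℕ) : ℚ⟦X⟧ := ∏ i ∈ Finset.range r, qp (f i - f (i + 1))


/-- The variable `x_j` (1-indexed, `1 ≤ j ≤ r`) of `ℤ[x_1,…,x_r,q]`, with the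
conventions `x_j = 0` for `j < 1` and `x_j = 1` for `j > r`. -/
def xv (r j : ℕ) : MvPolynomial (Fin (r + 1)) ℤ :=
  if h : 1 ≤ j ∧ j ≤ r then MvPolynomial.X ⟨j - 1, by omega⟩
  else if j = 0 then 0 else 1

/-- The variable `q` of `ℤ[x_1,…,x_r,q]`. -/
def qv (r : ℕ) : MvPolynomial (Fin (r + 1)) ℤ := MvPolynomial.X (Fin.last r)

/-- Evaluation of `P ∈ ℤ[x_1,…,x_r,q]` at `x_j = q^{λ_j}` and `q = X` in
`ℚ⟦X⟧`; here `f` is the 0-indexed tuple `(λ_1, …, λ_r)`. -/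
def pEval (r : ℕ) (f : ℕ → ℕ) (P : MvPolynomial (Fin (r + 1)) ℤ) : ℚ⟦X⟧ :=
  MvPolynomial.aeval
    (fun i : Fin (r + 1) => if (i : ℕ) < r then (X : ℚ⟦X⟧) ^ f i else X) P

/-- The relation `P ≈ Q`:
`Σ_{λ_1 ≥ … ≥ λ_r ≥ 0} q^{Σ (λ_i²+λ_i)/2}/(q)_λ · (P(q^{λ_1},…,q^{λ_r},q) - Q(q^{λ_1},…,q^{λ_r},q)) = 0`. -/
def papprox (r : ℕ) (P Q : MvPolynomial (Fin (r + 1)) ℤ) : Prop :=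
  ∑' f : DecTuple r,
    (X : ℚ⟦X⟧) ^ (∑ i ∈ Finset.range r, f.1 i * (f.1 i + 1) / 2) * (qpT r f.1)⁻¹ *
      (pEval r f.1 P - pEval r f.1 Q) = 0

theorem qp_succ (n : ℕ) : qp (n + 1) = qp n * (1 - X ^ (n + 1)) :=
  Finset.prod_range_succ _ _

theorem constantCoeff_qp (n : ℕ) : constantCoeff (qp n) = 1 := by
  simp [qp, map_prod]

theorem constantCoeff_qpT (r : ℕ) (f : ℕ → ℕ) : constantCoeff (qpT r f) = 1 := by
  simp [qpT, map_prod, constantCoeff_qp]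

theorem qpT_ne_zero (r : ℕ) (f : ℕ → ℕ) : constantCoeff (qpT r f) ≠ 0 := by
  simp [constantCoeff_qpT]

section Eval

variable {r : ℕ} {f g : ℕ → ℕ}

theorem pEval_add (P Q : MvPolynomial (Fin (r + 1)) ℤ) :
    pEval r f (P + Q) = pEval r f P + pEval r f Q := by
  simp [pEval]

theorem pEval_mul (P Q : MvPolynomial (Fin (r + 1)) ℤ) :
    pEval r f (P * Q) = pEval r f P * pEval r f Q := by
  simp [pEval]

theorem pEval_one : pEval r f 1 = 1 := by
  simp [pEval]

theorem pEval_qv : pEval r f (qv r) = X := by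
  simp [pEval, qv]

theorem pEval_xv_zero : pEval r f (xv r 0) = 0 := by
  simp [pEval, xv]

theorem pEval_xv_succ (hf : ∀ i, r ≤ i → f i = 0) (j : ℕ) :
    pEval r f (xv r (j + 1)) = X ^ f j := by
  by_cases h : j < r
  · simp [pEval, xv, h, Nat.succ_le_of_lt h]
  · have h' : ¬ j + 1 ≤ r := by omega
    simp [pEval, xv, h', hf j (by omega)]

/-- The evaluation of a polynomial only depends on the variables occurring in it. -/
theorem pEval_congr (P : MvPolynomial (Fin (r + 1)) ℤ)
    (h : ∀ i : Fin (r + 1), (i : ℕ) < r → i ∈ P.vars → f i = g i) :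
    pEval r f P = pEval r g P := by
  unfold pEval
  refine MvPolynomial.eval₂Hom_congr' rfl (fun i hi _ => ?_) rfl
  split_ifs with hr
  · rw [h i hr hi]
  · rfl

end Eval

/-- The exponent `Σ λ_i (λ_i + 1) / 2`. -/
def triSum (r : ℕ) (f : ℕ → ℕ) : ℕ := ∑ i ∈ Finset.range r, f i * (f i + 1) / 2

theorem apply_zero_le_triSum {r : ℕ} (hr : 1 ≤ r) (f : ℕ → ℕ) : f 0 ≤ triSum r f := by
  refine le_trans ?_ (Finset.single_le_sum (f := fun i => f i * (f i + 1) / 2)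
    (fun _ _ => Nat.zero_le _) (Finset.mem_range.2 hr))
  rw [Nat.le_div_iff_mul_le two_pos]
  rcases Nat.eq_zero_or_pos (f 0) with h | h
  · simp [h]
  · exact Nat.mul_le_mul_left _ (by omega)

theorem finite_decTuple_apply_zero_le (r N : ℕ) : {f : DecTuple r | f.1 0 ≤ N}.Finite := by
  refine Set.Finite.of_finite_image (f := fun f (i : Fin r) => f.1 i) ?_ ?_
  · refine (Set.Finite.pi' (t := fun _ => Set.Iic N) fun _ => Set.finite_Iic N).subset ?_
    rintro _ ⟨f, hf, rfl⟩ i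
    exact (f.2.1 (Nat.zero_le _)).trans hf
  · intro f _ g _ hfg
    refine Subtype.ext (funext fun i => ?_)
    by_cases hi : i < r
    · exact congrFun hfg ⟨i, hi⟩
    · rw [f.2.2 i (by omega), g.2.2 i (by omega)]

/-- A family on decreasing tuples divisible by the quadratic power of `q` is summable. -/
theorem summable_X_pow_triSum_mul {r : ℕ} (hr : 1 ≤ r) (u : DecTuple r → ℚ⟦X⟧) :
    Summable fun f : DecTuple r => X ^ triSum r f.1 * u f := by
  have key : Summable (fun f : DecTuple r =>
      ((X ^ triSum r f.1 * u f : ℚ⟦X⟧) : (Unit →₀ ℕ) → ℚ)) := by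
    refine Pi.summable.2 fun d => summable_of_hasFiniteSupport ?_
    refine (finite_decTuple_apply_zero_le r (d ())).subset fun f hf => ?_
    by_contra hlt
    refine hf ?_
    have hd : d = Finsupp.single () (d ()) := by ext; simp
    have hz : coeff (d ()) (X ^ triSum r f.1 * u f) = 0 :=
      X_pow_dvd_iff.1 (dvd_mul_right _ _) _
        (lt_of_lt_of_le (not_le.1 hlt) (apply_zero_le_triSum hr f.1))
    rw [coeff, ← hd] at hz
    exact hz
  exact key

/-- Increase the entry of index `p` by one. -/
def bump (p : ℕ) (f : ℕ → ℕ) : ℕ → ℕ := Function.update f p (f p + 1)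

theorem bump_self (p : ℕ) (f : ℕ → ℕ) : bump p f p = f p + 1 := by
  simp [bump]

theorem bump_of_ne {p i : ℕ} (h : i ≠ p) (f : ℕ → ℕ) : bump p f i = f i := by
  simp [bump, h]

theorem triSum_bump {r p : ℕ} (hp : p < r) (f : ℕ → ℕ) :
    triSum r (bump p f) = triSum r f + (f p + 1) := by
  have h : ∀ i ∈ Finset.range r, bump p f i * (bump p f i + 1) / 2 =
      f i * (f i + 1) / 2 + if i = p then f p + 1 else 0 := by
    intro i _
    by_cases hi : i = p
    · subst hi
      have := Nat.triangle_succ (f i + 1)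
      simp only [Nat.add_sub_cancel] at this
      rw [bump_self, if_pos rfl, mul_comm (f i + 1), this, mul_comm (f i)]
    · simp [bump_of_ne hi, hi]
  rw [triSum, Finset.sum_congr rfl h, Finset.sum_add_distrib, Finset.sum_ite_eq',
    if_pos (Finset.mem_range.2 hp), triSum]

/-- The factor `1 - q^(λ_{p-1} - λ_p)`, equal to `1` when `p` is the first index. -/
def gapFactor (p : ℕ) (f : ℕ → ℕ) : ℚ⟦X⟧ :=
  if p = 0 then 1 else 1 - X ^ (f (p - 1) - f p)

theorem qpT_bump {r p : ℕ} (hp : p < r) {f : ℕ → ℕ} (hle : f (p + 1) ≤ f p)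
    (hlt : p ≠ 0 → f p < f (p - 1)) :
    qpT r (bump p f) * gapFactor p f = qpT r f * (1 - X ^ (f p + 1 - f (p + 1))) := by
  have hc : gapFactor p f =
      ∏ i ∈ Finset.range r, if i + 1 = p then 1 - (X : ℚ⟦X⟧) ^ (f i - f p) else 1 := by
    rcases p with _ | p
    · simp [gapFactor]
    · simp [gapFactor, Finset.prod_ite_eq', show p < r by omega]
  have hd : (1 - (X : ℚ⟦X⟧) ^ (f p + 1 - f (p + 1))) =
      ∏ i ∈ Finset.range r, if i = p then 1 - (X : ℚ⟦X⟧) ^ (f p + 1 - f (p + 1)) else 1 := by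
    simp [Finset.prod_ite_eq', hp]
  rw [hc, hd, qpT, qpT, ← Finset.prod_mul_distrib, ← Finset.prod_mul_distrib]
  refine Finset.prod_congr rfl fun i _ => ?_
  by_cases hi : i = p
  · subst hi
    rw [bump_self, bump_of_ne (by omega), if_neg (by omega), if_pos rfl, mul_one,
      show f i + 1 - f (i + 1) = f i - f (i + 1) + 1 by omega, qp_succ]
  · by_cases hi' : i + 1 = p
    · subst hi'
      have := hlt (by omega)
      simp only [Nat.add_sub_cancel] at this
      rw [bump_self, bump_of_ne hi, if_pos rfl, if_neg hi, mul_one]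
      obtain ⟨k, hk⟩ := Nat.exists_eq_add_of_lt this
      rw [show f i - (f (i + 1) + 1) = k by omega, show f i - f (i + 1) = k + 1 by omega, qp_succ]
    · rw [bump_of_ne hi, bump_of_ne hi', if_neg hi, if_neg hi']

/-- The positive part of the telescoping decomposition in the entry of index `p`. -/
def upper (r p : ℕ) (P : MvPolynomial (Fin (r + 1)) ℤ) (f : ℕ → ℕ) : ℚ⟦X⟧ :=
  X ^ triSum r f *
    ((qpT r f)⁻¹ * (X ^ (f p + f (p + 1) + 1) * gapFactor p f) * pEval r f P)

/-- The negative part of the telescoping decomposition in the entry of index `p`. -/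
def lower (r p : ℕ) (P : MvPolynomial (Fin (r + 1)) ℤ) (f : ℕ → ℕ) : ℚ⟦X⟧ :=
  X ^ triSum r f *
    ((qpT r f)⁻¹ * (X ^ f (p + 1) * (1 - X ^ (f p - f (p + 1)))) * pEval r f P)

theorem summand_eq_upper_sub_lower (r p : ℕ) (P : MvPolynomial (Fin (r + 1)) ℤ)
    (f : DecTuple r) :
    (X : ℚ⟦X⟧) ^ (∑ i ∈ Finset.range r, f.1 i * (f.1 i + 1) / 2) * (qpT r f.1)⁻¹ *
      (pEval r f.1 (xv r (p + 1) * (1 + qv r * xv r (p + 1 + 1)) * P) -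
        pEval r f.1 (xv r (p + 1 + 1) * (1 + qv r * xv r p) * P)) =
      upper r p P f.1 - lower r p P f.1 := by
  obtain ⟨f, hanti, hzero⟩ := f
  obtain ⟨k, hk⟩ := Nat.exists_eq_add_of_le (hanti (Nat.le_add_right p 1))
  simp only [pEval_mul, pEval_add, pEval_one, pEval_qv, pEval_xv_succ hzero, upper, lower,
    gapFactor]
  rw [show ∑ i ∈ Finset.range r, f i * (f i + 1) / 2 = triSum r f from rfl]
  rcases p with _ | p
  · rw [pEval_xv_zero, if_pos rfl, show f 0 - f (0 + 1) = k by omega, hk]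
    ring
  · obtain ⟨l, hl⟩ := Nat.exists_eq_add_of_le (hanti (Nat.le_add_right p 1))
    rw [pEval_xv_succ hzero, if_neg (by omega), Nat.add_sub_cancel,
      show f (p + 1) - f (p + 1 + 1) = k by omega, show f p - f (p + 1) = l by omega, hl, hk]
    ring

theorem lower_bump {r p : ℕ} (hp : p < r) {P : MvPolynomial (Fin (r + 1)) ℤ}
    (hP : (⟨p, by omega⟩ : Fin (r + 1)) ∉ P.vars) {f : ℕ → ℕ} (hle : f (p + 1) ≤ f p)
    (hlt : p ≠ 0 → f p < f (p - 1)) :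
    lower r p P (bump p f) = upper r p P f := by
  have hinv : (qpT r (bump p f))⁻¹ * (1 - X ^ (f p + 1 - f (p + 1))) =
      (qpT r f)⁻¹ * gapFactor p f := by
    have h₁ := PowerSeries.inv_mul_cancel _ (qpT_ne_zero r (bump p f))
    have h₂ := PowerSeries.inv_mul_cancel _ (qpT_ne_zero r f)
    linear_combination (-(qpT r (bump p f))⁻¹ * (qpT r f)⁻¹) * qpT_bump hp hle hlt
      + (qpT r f)⁻¹ * gapFactor p f * h₁
      - (qpT r (bump p f))⁻¹ * (1 - X ^ (f p + 1 - f (p + 1))) * h₂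
  have hE : pEval r (bump p f) P = pEval r f P := by
    refine pEval_congr P fun i _ hi => bump_of_ne (fun h => hP ?_) f
    have : (⟨p, by omega⟩ : Fin (r + 1)) = i := Fin.ext h.symm
    rwa [this]
  rw [lower, upper, hE, triSum_bump hp, bump_self, bump_of_ne (by omega)]
  linear_combination (X ^ (triSum r f + (f p + 1)) * X ^ f (p + 1) * pEval r f P) * hinv

theorem lt_of_upper_ne_zero {r p : ℕ} {P : MvPolynomial (Fin (r + 1)) ℤ} {f : DecTuple r}
    (h : upper r p P f.1 ≠ 0) (hp : p ≠ 0) : f.1 p < f.1 (p - 1) := by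
  refine lt_of_le_of_ne (f.2.1 (Nat.sub_le p 1)) fun he => h ?_
  simp [upper, gapFactor, hp, he]

theorem lt_of_lower_ne_zero {r p : ℕ} {P : MvPolynomial (Fin (r + 1)) ℤ} {f : DecTuple r}
    (h : lower r p P f.1 ≠ 0) : f.1 (p + 1) < f.1 p := by
  refine lt_of_le_of_ne (f.2.1 (Nat.le_succ p)) fun he => h ?_
  simp [lower, he]

theorem bump_antitone {r p : ℕ} (hp : p < r) (f : DecTuple r)
    (hlt : p ≠ 0 → f.1 p < f.1 (p - 1)) :
    (∀ ⦃i j : ℕ⦄, i ≤ j → bump p f.1 j ≤ bump p f.1 i) ∧ ∀ i, r ≤ i → bump p f.1 i = 0 := by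
  refine ⟨fun i j hij => ?_, fun i hi => ?_⟩
  · have h₁ := f.2.1 hij
    by_cases hj : j = p
    · subst hj
      by_cases hi : i = j
      · rw [hi]
      · have h₂ := hlt (by omega)
        have h₃ := f.2.1 (show i ≤ j - 1 by omega)
        rw [bump_self, bump_of_ne hi]
        omega
    · rw [bump_of_ne hj]
      by_cases hi : i = p
      · rw [hi, bump_self, ← hi]
        omega
      · rwa [bump_of_ne hi]
  · rw [bump_of_ne (by omega), f.2.2 i hi]

theorem exists_bump_eq {r p : ℕ} (hp : p < r) (f : DecTuple r) (h : f.1 (p + 1) < f.1 p) :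
    ∃ g : DecTuple r, bump p g.1 = f.1 ∧ (p ≠ 0 → g.1 p < g.1 (p - 1)) := by
  refine ⟨⟨Function.update f.1 p (f.1 p - 1), fun i j hij => ?_, fun i hi => ?_⟩, ?_, fun h0 => ?_⟩
  · have h₁ := f.2.1 hij
    by_cases hi : i = p
    · subst hi
      by_cases hj : j = i
      · rw [hj]
      · have h₃ := f.2.1 (show i + 1 ≤ j by omega)
        simp only [Function.update_self, Function.update_of_ne hj]
        omega
    · rw [Function.update_of_ne hi]
      by_cases hj : j = p
      · rw [hj, Function.update_self, ← hj]
        omega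
      · rwa [Function.update_of_ne hj]
  · rw [Function.update_of_ne (by omega), f.2.2 i hi]
  · simp only [bump, Function.update_self, Function.update_idem,
      show f.1 p - 1 + 1 = f.1 p by omega, Function.update_eq_self]
  · have := f.2.1 (Nat.sub_le p 1)
    simp only [Function.update_self, Function.update_of_ne (show p - 1 ≠ p by omega)]
    omega

theorem bump_injective (p : ℕ) : Function.Injective (bump p) := by
  intro f g h
  funext i
  have hi := congrFun h i
  by_cases hip : i = p
  · subst hip
    simpa [bump_self] using hi
  · simpa [bump_of_ne hip] using hi

theorem tsum_lower_eq_tsum_upper {r p : ℕ} (hp : p < r) {P : MvPolynomial (Fin (r + 1)) ℤ}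
    (hP : (⟨p, by omega⟩ : Fin (r + 1)) ∉ P.vars) :
    ∑' f : DecTuple r, lower r p P f.1 = ∑' f : DecTuple r, upper r p P f.1 := by
  have hbump (f : DecTuple r) (hlt : p ≠ 0 → f.1 p < f.1 (p - 1)) :
      lower r p P (bump p f.1) = upper r p P f.1 :=
    lower_bump hp hP (f.2.1 (Nat.le_succ p)) hlt
  refine tsum_eq_tsum_of_ne_zero_bij
    (fun f => ⟨bump p f.1.1, bump_antitone hp f.1 (lt_of_upper_ne_zero f.2)⟩) ?_ ?_ ?_
  · intro f g h
    exact Subtype.ext (Subtype.ext (bump_injective p (congrArg Subtype.val h)))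
  · intro f hf
    obtain ⟨g, hg, hlt⟩ := exists_bump_eq hp f (lt_of_lower_ne_zero hf)
    refine ⟨⟨g, ?_⟩, Subtype.ext hg⟩
    rw [Function.mem_support, ← hbump g hlt, hg]
    exact hf
  · intro f
    exact hbump f.1 (lt_of_upper_ne_zero f.2)

/-- Lemma `simple transformation`:
`x_s (1 + q x_{s+1}) P ≈ x_{s+1} (1 + q x_{s-1}) P` for `P` not involving `x_s`
(with `x_0 = 0`, `x_{r+1} = 1`). -/
theorem stmt6 (r s : ℕ) (hr : 1 ≤ r) (hs1 : 1 ≤ s) (hs2 : s ≤ r)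
    (P : MvPolynomial (Fin (r + 1)) ℤ)
    (hP : (⟨s - 1, by omega⟩ : Fin (r + 1)) ∉ P.vars) :
    papprox r (xv r s * (1 + qv r * xv r (s + 1)) * P)
      (xv r (s + 1) * (1 + qv r * xv r (s - 1)) * P) := by
  obtain ⟨p, rfl⟩ := Nat.exists_eq_add_of_le' hs1
  have : IsTopologicalAddGroup ℚ⟦X⟧ :=
    inferInstanceAs (IsTopologicalAddGroup ((Unit →₀ ℕ) → ℚ))
  have : T2Space ℚ⟦X⟧ := inferInstanceAs (T2Space ((Unit →₀ ℕ) → ℚ))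
  have hp : p < r := hs2
  simp only [Nat.add_sub_cancel] at hP ⊢
  have hU : Summable fun f : DecTuple r => upper r p P f.1 := summable_X_pow_triSum_mul hr _
  have hL : Summable fun f : DecTuple r => lower r p P f.1 := summable_X_pow_triSum_mul hr _
  rw [papprox, tsum_congr (summand_eq_upper_sub_lower r p P), hU.tsum_sub hL,
    tsum_lower_eq_tsum_upper hp hP, sub_self]
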